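/- Let d be a positive integer and let Ω ⊆ ℝ^d be a locally compact set. Then for a typical function f ∈ C(Ω) there is an F_σ set F ⊆ Ω such that: (i) for every x ∉ F and every s > 0, lip_s f(x) = 0; and (ii) the lower packing dimension of F is at most d−1. If, moreover, Ω has nonempty interior, then F can be chosen so that additionally lpdim F = hdim F = d−1. -/

import Mathlib

open Filter Set Topology MeasureTheory
open scoped ENNReal NNReal

noncomputable section

/-- A gauge: nondecreasing on `[0,∞)`, right-continuous, `φ 0 = 0`, positive on `(0,∞)`. -/
def IsGauge (φ : ℝ → ℝ) : Prop :=
  (∀ ⦃a b : ℝ⦄, 0 ≤ a → a ≤ b → φ a ≤ φ b) ∧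
  (∀ a : ℝ, 0 ≤ a → ContinuousWithinAt φ (Set.Ici a) a) ∧
  φ 0 = 0 ∧ (∀ r : ℝ, 0 < r → 0 < φ r)

/-- `N_δ(E)`: the least number of sets of diameter at most `δ` needed to cover `E`. -/
def coverNum {X : Type*} [PseudoMetricSpace X] (δ : ℝ) (E : Set X) : ℝ≥0∞ :=
  ⨅ (n : ℕ) (_ : ∃ F : Fin n → Set X,
    (∀ i, EMetric.diam (F i) ≤ ENNReal.ofReal δ) ∧ E ⊆ ⋃ i, F i), (n : ℝ≥0∞)

/-- `ν_0^ζ(E) = liminf_{δ→0+} N_δ(E)·ζ(δ)`. -/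
def nu0 {X : Type*} [PseudoMetricSpace X] (ζ : ℝ → ℝ) (E : Set X) : ℝ≥0∞ :=
  Filter.liminf (fun δ : ℝ => coverNum δ E * ENNReal.ofReal (ζ δ)) (𝓝[>] (0:ℝ))

/-- The lower box-counting measure `ν^ζ`. -/
def lowerBoxMeasure {X : Type*} [PseudoMetricSpace X] (ζ : ℝ → ℝ) (E : Set X) : ℝ≥0∞ :=
  ⨅ (G : ℕ → Set X) (_ : E ⊆ ⋃ n, G n), ∑' n, nu0 ζ (G n)

/-- The lower box dimension `lbdim E = liminf_{r→0+} log N_r(E)/|log r|`. -/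
def lbdim {X : Type*} [PseudoMetricSpace X] (E : Set X) : EReal :=
  Filter.liminf (fun r : ℝ => ENNReal.log (coverNum r E) * ((|Real.log r|⁻¹ : ℝ) : EReal))
    (𝓝[>] (0:ℝ))

/-- The lower packing dimension. -/
def lpdim {X : Type*} [PseudoMetricSpace X] (E : Set X) : EReal :=
  ⨅ (G : ℕ → Set X) (_ : E ⊆ ⋃ n, G n), ⨆ n, lbdim (G n)

/-- The generalized lower scaled oscillation `lip_φ f`. -/
def lipGauge {X : Type*} [PseudoMetricSpace X] (φ : ℝ → ℝ) (f : X → ℝ) (x : X) : ℝ≥0∞ :=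
  Filter.liminf
    (fun r : ℝ => EMetric.diam (f '' Metric.closedBall x r) / ENNReal.ofReal (φ r))
    (𝓝[>] (0:ℝ))

/-- The upper scaled oscillation `Lip f`. -/
def LipGauge {X : Type*} [PseudoMetricSpace X] (φ : ℝ → ℝ) (f : X → ℝ) (x : X) : ℝ≥0∞ :=
  Filter.limsup
    (fun r : ℝ => EMetric.diam (f '' Metric.closedBall x r) / ENNReal.ofReal (φ r))
    (𝓝[>] (0:ℝ))

/-- The Hausdorff measure with gauge `ξ`. -/
def hausdorffGauge {X : Type*} [PseudoMetricSpace X] (ξ : ℝ → ℝ) (E : Set X) : ℝ≥0∞ :=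
  ⨆ (δ : ℝ) (_ : 0 < δ), ⨅ (G : ℕ → Set X) (_ : E ⊆ ⋃ n, G n)
    (_ : ∀ n, EMetric.diam (G n) ≤ ENNReal.ofReal δ),
    ∑' n, ENNReal.ofReal (ξ (EMetric.diam (G n)).toReal)

/-- A box in `ℝ^k`. -/
def IsBox {k : ℕ} (S : Set (EuclideanSpace ℝ (Fin k))) : Prop :=
  ∃ a b : Fin k → ℝ, S = {x | ∀ i, x i ∈ Set.Icc (a i) (b i)}

/-- A microscopic subset of `ℝ^k`. -/
def Microscopic {k : ℕ} (X : Set (EuclideanSpace ℝ (Fin k))) : Prop :=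
  ∀ ε : ℝ, 0 < ε → ∃ B : ℕ → Set (EuclideanSpace ℝ (Fin k)),
    (∀ n, IsBox (B n)) ∧ X ⊆ ⋃ n, B n ∧
    ∀ n, MeasureTheory.volume (B n) ≤ ENNReal.ofReal (ε ^ (n + 1))

/-- A microscopic subset of `ℝ`. -/
def MicroscopicR (E : Set ℝ) : Prop :=
  ∀ ε : ℝ, 0 < ε → ∃ I : ℕ → ℝ × ℝ,
    E ⊆ ⋃ n, Set.Icc (I n).1 (I n).2 ∧
    ∀ n, MeasureTheory.volume (Set.Icc (I n).1 (I n).2) ≤ ENNReal.ofReal (ε ^ (n + 1))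

end

/-- A continuous staircase on `ℝ`: equal to `⌊u⌋` unless `u` is within `τ` below an integer. -/
noncomputable def stair (τ u : ℝ) : ℝ := u + (max 0 (1 - (1 - Int.fract u) / τ) - Int.fract u)

lemma continuous_stair {τ : ℝ} (h0 : 0 < τ) (h1 : τ ≤ 1) : Continuous (stair τ) := by
  have h : Continuous ((fun v : ℝ => max 0 (1 - (1 - v) / τ) - v) ∘ Int.fract) := by
    refine ContinuousOn.comp_fract'' (by fun_prop) ?_
    have : (1 : ℝ) ≤ 1 / τ := by rw [le_div_iff₀ h0]; linarith
    simp only [sub_zero, sub_self, zero_div]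
    rw [max_eq_left (by linarith), max_eq_right (by norm_num)]
    norm_num
  exact continuous_id.add h

lemma abs_stair_sub_le {τ : ℝ} (h0 : 0 < τ) (u : ℝ) : |stair τ u - u| ≤ 1 := by
  have h1 := Int.fract_nonneg u
  have h2 := Int.fract_lt_one u
  have h3 : 0 ≤ (1 - Int.fract u) / τ := div_nonneg (by linarith) h0.le
  have h4 : max 0 (1 - (1 - Int.fract u) / τ) ≤ 1 := max_le (by norm_num) (by linarith)
  have h5 := le_max_left 0 (1 - (1 - Int.fract u) / τ)
  rw [stair, add_sub_cancel_left, abs_le]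
  constructor <;> linarith

lemma stair_eq_floor {τ u w : ℝ} (h0 : 0 < τ)
    (hu : 2 * τ < min (Int.fract u) (1 - Int.fract u)) (hw : |w - u| ≤ τ) :
    stair τ w = ⌊u⌋ := by
  obtain ⟨h1, h2⟩ := lt_min_iff.1 hu
  obtain ⟨h3, h4⟩ := abs_le.1 hw
  have h5 := Int.self_sub_floor u
  have h6 : ⌊w⌋ = ⌊u⌋ := by
    rw [Int.floor_eq_iff]
    constructor <;> linarith
  have h7 := Int.self_sub_floor w
  rw [h6] at h7
  have h8 : 1 ≤ (1 - Int.fract w) / τ := by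
    rw [le_div_iff₀ h0]; linarith
  rw [stair, max_eq_left (by linarith)]
  linarith

/-- The points of `ℝ^d` with a coordinate within `2 * t` of the grid `c + h * ℤ`. -/
def gridSlab (d : ℕ) (c h t : ℝ) : Set (EuclideanSpace ℝ (Fin d)) :=
  {x | ∃ i, min (Int.fract ((x i - c) / h)) (1 - Int.fract ((x i - c) / h)) ≤ 2 * (t / h)}

lemma isClosed_gridSlab (d : ℕ) (c h t : ℝ) : IsClosed (gridSlab d c h t) := by
  have hc : Continuous ((fun v : ℝ => min v (1 - v)) ∘ Int.fract) :=
    ContinuousOn.comp_fract'' (by fun_prop) (by norm_num)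
  have hU : gridSlab d c h t = ⋃ i, {x : EuclideanSpace ℝ (Fin d) |
      min (Int.fract ((x i - c) / h)) (1 - Int.fract ((x i - c) / h)) ≤ 2 * (t / h)} := by
    ext x
    simp [gridSlab]
  rw [hU]
  refine isClosed_iUnion_of_finite fun i => ?_
  have h2 : Continuous fun x : EuclideanSpace ℝ (Fin d) => (x i - c) / h := by fun_prop
  exact isClosed_le (hc.comp h2) continuous_const

lemma mem_gridSlab_of_eq {d : ℕ} {c h t : ℝ} (hh : 0 < h) (ht : 0 < t)
    {x : EuclideanSpace ℝ (Fin d)} {i : Fin d} (hx : x i = c) : x ∈ gridSlab d c h t := by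
  refine ⟨i, ?_⟩
  simp only [hx, sub_self, zero_div, Int.fract_zero, sub_zero]
  exact (min_le_left _ _).trans (by positivity)

lemma exists_int_of_mem_gridSlab {d : ℕ} {c h t : ℝ} (hh : 0 < h)
    {x : EuclideanSpace ℝ (Fin d)} (hx : x ∈ gridSlab d c h t) :
    ∃ i, ∃ k : ℤ, |x i - (c + k * h)| ≤ 2 * t := by
  obtain ⟨i, hi⟩ := hx
  set v := (x i - c) / h with hv
  have hx : x i - c = v * h := by rw [hv]; field_simp
  have key : ∃ k : ℤ, |v - k| ≤ 2 * (t / h) := by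
    have h5 := Int.self_sub_floor v
    rcases min_le_iff.1 hi with h1 | h1
    · exact ⟨⌊v⌋, by rw [h5, abs_of_nonneg (Int.fract_nonneg v)]; exact h1⟩
    · refine ⟨⌊v⌋ + 1, ?_⟩
      have := Int.fract_lt_one v
      push_cast
      rw [abs_sub_comm, abs_of_nonneg (by linarith)]
      linarith
  obtain ⟨k, hk⟩ := key
  refine ⟨i, k, ?_⟩
  have : x i - (c + k * h) = (v - k) * h := by linear_combination hx
  rw [this, abs_mul, abs_of_pos hh]
  calc |v - k| * h ≤ 2 * (t / h) * h := by gcongr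
    _ = 2 * t := by field_simp

/-- The staircase applied to every coordinate, on the grid `c + h * ℤ`. -/
noncomputable def gridStair (d : ℕ) (c h t : ℝ) (x : EuclideanSpace ℝ (Fin d)) : EuclideanSpace ℝ (Fin d) :=
  WithLp.toLp 2 fun i => c + h * stair (t / h) ((x i - c) / h)

lemma continuous_gridStair {d : ℕ} {c h t : ℝ} (ht : 0 < t) (hth : t ≤ h) :
    Continuous (gridStair d c h t) := by
  have hh : 0 < h := ht.trans_le hth
  have hs := continuous_stair (div_pos ht hh) ((div_le_one hh).2 hth)
  refine (PiLp.continuous_toLp 2 _).comp (continuous_pi fun i => ?_)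
  have h2 : Continuous fun x : EuclideanSpace ℝ (Fin d) => (x i - c) / h := by fun_prop
  exact continuous_const.add (continuous_const.mul (hs.comp h2))

lemma EuclideanSpace.dist_le_card_mul {d : ℕ} {x y : EuclideanSpace ℝ (Fin d)} {δ : ℝ}
    (hδ : 0 ≤ δ) (h : ∀ i, |x i - y i| ≤ δ) : dist x y ≤ d * δ := by
  rw [EuclideanSpace.dist_eq]
  refine Real.sqrt_le_iff.2 ⟨by positivity, ?_⟩
  calc ∑ i, dist (x i) (y i) ^ 2 ≤ ∑ _i : Fin d, δ ^ 2 := by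
        gcongr with i
        exact h i
    _ = d * δ ^ 2 := by simp
    _ ≤ (d : ℝ) ^ 2 * δ ^ 2 := by
        gcongr
        exact_mod_cast Nat.le_self_pow two_ne_zero d
    _ = (d * δ) ^ 2 := by ring

lemma dist_gridStair_le {d : ℕ} {c h t : ℝ} (ht : 0 < t) (hh : 0 < h)
    (x : EuclideanSpace ℝ (Fin d)) : dist x (gridStair d c h t x) ≤ d * h := by
  refine EuclideanSpace.dist_le_card_mul hh.le fun i => ?_
  have h1 := abs_stair_sub_le (div_pos ht hh) ((x i - c) / h)
  have h2 : x i - gridStair d c h t x i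
      = h * -(stair (t / h) ((x i - c) / h) - (x i - c) / h) := by
    simp only [gridStair]
    field_simp
    ring
  rw [h2, abs_mul, abs_neg, abs_of_pos hh]
  exact mul_le_of_le_one_right hh.le h1

lemma gridStair_eq_of_notMem {d : ℕ} {c h t : ℝ} (ht : 0 < t) (hh : 0 < h)
    {x y : EuclideanSpace ℝ (Fin d)} (hx : x ∉ gridSlab d c h t) (hy : dist y x ≤ t) :
    gridStair d c h t y = gridStair d c h t x := by
  simp only [gridSlab, mem_ofPred_eq, not_exists, not_le] at hx
  have key : ∀ z : EuclideanSpace ℝ (Fin d), dist z x ≤ t → ∀ i,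
      stair (t / h) ((z i - c) / h) = ⌊(x i - c) / h⌋ := by
    intro z hz i
    refine stair_eq_floor (div_pos ht hh) (hx i) ?_
    rw [← sub_div, abs_div, abs_of_pos hh]
    gcongr
    have := (PiLp.norm_apply_le (z - x) i).trans_eq (dist_eq_norm z x).symm
    rw [sub_sub_sub_cancel_right]
    exact (this.trans hz)
  simp only [gridStair, key y hy, key x (by simpa using ht.le)]

lemma coverNum_le_card {X ι : Type*} [PseudoMetricSpace X] {δ : ℝ} {E : Set X}
    (T : Finset ι) (j : X → ι) (hT : ∀ x ∈ E, j x ∈ T)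
    (hj : ∀ x ∈ E, ∀ y ∈ E, j x = j y → dist x y ≤ δ) : coverNum δ E ≤ T.card := by
  refine iInf₂_le T.card ⟨fun a => {x ∈ E | j x = T.equivFin.symm a}, fun a => ?_, fun x hx => ?_⟩
  · refine Metric.ediam_le fun x hx y hy => ?_
    rw [edist_dist]
    exact ENNReal.ofReal_le_ofReal (hj x hx.1 y hy.1 (hx.2.trans hy.2.symm))
  · exact mem_iUnion.2 ⟨T.equivFin ⟨j x, hT x hx⟩, hx, by simp⟩

lemma coverNum_mono {X : Type*} [PseudoMetricSpace X] {δ : ℝ} {E E' : Set X} (h : E ⊆ E') :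
    coverNum δ E ≤ coverNum δ E' :=
  le_iInf₂ fun n ⟨F, hF, hE⟩ => iInf₂_le n ⟨F, hF, h.trans hE⟩

lemma card_Icc_floor_le {a b : ℝ} (hab : a ≤ b) :
    ((Finset.Icc ⌊a⌋ ⌊b⌋).card : ℝ) ≤ b - a + 2 := by
  have h : ⌊a⌋ ≤ ⌊b⌋ + 1 := (Int.floor_mono hab).trans (by omega)
  have h2 : ((Finset.Icc ⌊a⌋ ⌊b⌋).card : ℤ) = ⌊b⌋ + 1 - ⌊a⌋ := Int.card_Icc_of_le _ _ h
  have h3 : ((Finset.Icc ⌊a⌋ ⌊b⌋).card : ℝ) = ⌊b⌋ + 1 - ⌊a⌋ := by exact_mod_cast h2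
  linarith [Int.floor_le b, Int.lt_floor_add_one a]

/-- A bounded piece of the grid neighbourhood is, at scale `t`, of box dimension `d - 1`. -/
lemma exists_coverNum_gridSlab_le {d : ℕ} (hd : 0 < d) (c : ℝ) {h : ℝ} (hh : 0 < h)
    {R : ℝ} (hR : 0 ≤ R) :
    ∃ C : ℝ, ∀ t : ℝ, 0 < t → t < 1 →
      coverNum t (gridSlab d c h t ∩ Metric.closedBall 0 R) ≤
        ENNReal.ofReal (C * t ^ (-((d - 1 : ℕ) : ℝ))) := by
  classical
  have hd0 : (0 : ℝ) < d := by exact_mod_cast hd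
  set M : ℤ := ⌈(R + |c| + 2) / h⌉
  refine ⟨d * ((Finset.Icc (-M) M).card + 1) * (4 * d + 2) * (2 * R * d + 2) ^ (d - 1),
    fun t ht ht1 => ?_⟩
  set δ : ℝ := t / d with hδ
  have hδ0 : 0 < δ := div_pos ht hd0
  set B : Finset ℤ := Finset.Icc ⌊-R / δ⌋ ⌊R / δ⌋ with hB
  let A : ℤ → Finset ℤ := fun k =>
    Finset.Icc ⌊(c + k * h - 2 * t) / δ⌋ ⌊(c + k * h + 2 * t) / δ⌋
  let T : Finset (Fin d → ℤ) := Finset.univ.biUnion fun i : Fin d =>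
    (Finset.Icc (-M) M).biUnion fun k =>
      Fintype.piFinset (Function.update (fun _ => B) i (A k))
  have hBc : (B.card : ℝ) ≤ (2 * R * d + 2) * t⁻¹ := by
    have h1 := card_Icc_floor_le (a := -R / δ) (b := R / δ) (by gcongr; linarith)
    have h2 : R / δ - -R / δ = 2 * R * d * t⁻¹ := by rw [hδ]; field_simp; ring
    have h3 : 1 ≤ t⁻¹ := (one_le_inv₀ ht).2 ht1.le
    rw [h2] at h1
    linarith
  have hAc : ∀ k, ((A k).card : ℝ) ≤ 4 * d + 2 := by
    intro k
    have h1 := card_Icc_floor_le (a := (c + k * h - 2 * t) / δ) (b := (c + k * h + 2 * t) / δ)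
      (by gcongr; linarith)
    have h2 : (c + k * h + 2 * t) / δ - (c + k * h - 2 * t) / δ = 4 * d := by
      rw [hδ]; field_simp; ring
    rwa [h2] at h1
  have hTc : (T.card : ℝ) ≤ d * (Finset.Icc (-M) M).card *
      ((4 * d + 2) * ((2 * R * d + 2) * t⁻¹) ^ (d - 1)) := by
    have h1 : ∀ (i : Fin d) (k : ℤ),
        ((Fintype.piFinset (Function.update (fun _ => B) i (A k))).card : ℝ) ≤
          (4 * d + 2) * ((2 * R * d + 2) * t⁻¹) ^ (d - 1) := by
      intro i k
      have h2 : ∀ a, (Function.update (fun _ : Fin d => B) i (A k) a).card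
          = Function.update (fun _ : Fin d => B.card) i (A k).card a := by
        intro a
        by_cases ha : a = i
        · subst ha; simp
        · simp [ha]
      rw [Fintype.card_piFinset, Finset.prod_congr rfl fun a _ => h2 a,
        Finset.prod_update_of_mem (Finset.mem_univ i)]
      simp only [Finset.prod_const, Finset.card_univ_sdiff, Fintype.card_fin,
        Finset.card_singleton]
      push_cast
      gcongr
      exact hAc k
    have h3 : (T.card : ℝ) ≤ ∑ i : Fin d, ∑ k ∈ Finset.Icc (-M) M,
        ((Fintype.piFinset (Function.update (fun _ => B) i (A k))).card : ℝ) := by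
      have h4 : T.card ≤ ∑ i : Fin d, ∑ k ∈ Finset.Icc (-M) M,
          (Fintype.piFinset (Function.update (fun _ => B) i (A k))).card :=
        Finset.card_biUnion_le.trans (Finset.sum_le_sum fun i _ => Finset.card_biUnion_le)
      exact_mod_cast h4
    refine h3.trans ((Finset.sum_le_sum fun i _ => Finset.sum_le_sum fun k _ => h1 i k).trans ?_)
    simp [mul_assoc]
  refine (coverNum_le_card T (fun x i => ⌊x i / δ⌋) ?_ ?_).trans ?_
  · rintro x ⟨hx, hxR⟩
    have hxi : ∀ i, |x i| ≤ R := fun i =>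
      (PiLp.norm_apply_le x i).trans (mem_closedBall_zero_iff.1 hxR)
    obtain ⟨i, k, hk⟩ := exists_int_of_mem_gridSlab hh hx
    have hkM : |(k : ℝ)| ≤ (R + |c| + 2) / h := by
      rw [le_div_iff₀ hh]
      rw [← abs_of_pos hh, ← abs_mul, abs_le]
      obtain ⟨h1, h2⟩ := abs_le.1 hk
      obtain ⟨h3, h4⟩ := abs_le.1 (hxi i)
      constructor <;> linarith [neg_abs_le c, le_abs_self c]
    have hkM' : |k| ≤ M := by
      have := hkM.trans (Int.le_ceil _)
      exact_mod_cast this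
    simp only [T, Finset.mem_biUnion, Finset.mem_univ, true_and]
    refine ⟨i, k, Finset.mem_Icc.2 (abs_le.1 hkM'), Fintype.mem_piFinset.2 fun a => ?_⟩
    by_cases ha : a = i
    · subst ha
      obtain ⟨h1, h2⟩ := abs_le.1 hk
      simp only [Function.update_self, A, Finset.mem_Icc]
      constructor <;> · apply Int.floor_mono; gcongr; linarith
    · obtain ⟨h1, h2⟩ := abs_le.1 (hxi a)
      simp only [Function.update_of_ne ha, hB, Finset.mem_Icc]
      constructor <;> · apply Int.floor_mono; gcongr
  · intro x _ y _ hxy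
    have : (d : ℝ) * δ = t := by rw [hδ]; field_simp
    rw [← this]
    refine EuclideanSpace.dist_le_card_mul hδ0.le fun i => ?_
    have h1 := Int.abs_sub_lt_one_of_floor_eq_floor (congrFun hxy i)
    rw [← sub_div, abs_div, abs_of_pos hδ0, div_lt_one hδ0] at h1
    exact h1.le
  · rw [← ENNReal.ofReal_natCast]
    refine ENNReal.ofReal_le_ofReal (hTc.trans ?_)
    rw [Real.rpow_neg ht.le, Real.rpow_natCast, mul_pow, inv_pow]
    have : (0 : ℝ) ≤ d * ((4 * d + 2) * ((2 * R * d + 2) ^ (d - 1) * (t ^ (d - 1))⁻¹)) := by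
      positivity
    nlinarith

lemma coverNum_one_le {X : Type*} [PseudoMetricSpace X] {δ : ℝ} {E : Set X} (hE : E.Nonempty) :
    1 ≤ coverNum δ E := by
  refine le_iInf₂ fun n ⟨F, _, hF⟩ => ?_
  obtain ⟨x, hx⟩ := hE
  obtain ⟨i, _⟩ := mem_iUnion.1 (hF hx)
  exact_mod_cast i.pos

lemma lbdim_nonneg {X : Type*} [PseudoMetricSpace X] {E : Set X} (hE : E.Nonempty) :
    0 ≤ lbdim E := by
  refine le_liminf_of_le (by isBoundedDefault) (Eventually.of_forall fun r => ?_)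
  refine mul_nonneg ?_ (by exact_mod_cast inv_nonneg.2 (abs_nonneg _))
  rw [← ENNReal.log_one]
  exact ENNReal.log_monotone (coverNum_one_le hE)

lemma exists_cover_of_coverNum_lt {X : Type*} [PseudoMetricSpace X] {δ : ℝ} {E : Set X}
    {a : ℝ≥0∞} (h : coverNum δ E < a) :
    ∃ (n : ℕ) (F : Fin n → Set X), (∀ i, Metric.ediam (F i) ≤ ENNReal.ofReal δ) ∧
      E ⊆ (⋃ i, F i) ∧ (n : ℝ≥0∞) < a := by
  simp only [coverNum, iInf_lt_iff] at h
  obtain ⟨n, ⟨F, hF, hE⟩, hn⟩ := h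
  exact ⟨n, F, hF, hE, hn⟩

lemma dimH_le_of_lbdim_lt {X : Type*} [MetricSpace X] {E : Set X} {s : ℝ≥0}
    (h : lbdim E < ((s : ℝ) : EReal)) : dimH E ≤ s := by
  borelize X
  have hf := frequently_lt_of_liminf_lt (by isBoundedDefault) h
  have key : ∀ n : ℕ, ∃ (k : ℕ) (F : Fin k → Set X) (r : ℝ), 0 < r ∧ r < 1 / (n + 1) ∧
      (∀ i, Metric.ediam (F i) ≤ ENNReal.ofReal r) ∧ E ⊆ (⋃ i, F i) ∧
      (k : ℝ≥0∞) < ENNReal.ofReal (r ^ (-(s : ℝ))) := by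
    intro n
    have hlt : ∀ᶠ r : ℝ in 𝓝[>] (0 : ℝ), r ∈ Ioo (0 : ℝ) (min 1 (1 / (n + 1))) :=
      Ioo_mem_nhdsGT (by positivity)
    obtain ⟨r, hr, hr0, hr1⟩ := (hf.and_eventually hlt).exists
    obtain ⟨hr1, hr2⟩ := lt_min_iff.1 hr1
    have hlog : Real.log r < 0 := Real.log_neg hr0 hr1
    have hc : coverNum r E < ENNReal.ofReal (r ^ (-(s : ℝ))) := by
      by_contra hcon
      rw [not_lt] at hcon
      refine hr.not_ge ?_
      have h1 := ENNReal.log_monotone hcon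
      rw [ENNReal.log_ofReal_of_pos (Real.rpow_pos_of_pos hr0 _), Real.log_rpow hr0] at h1
      have h2 : (s : ℝ) = -s * Real.log r * |Real.log r|⁻¹ := by
        rw [abs_of_neg hlog, neg_mul, inv_neg, neg_mul_neg, mul_inv_cancel_right₀ hlog.ne]
      calc ((s : ℝ) : EReal) = ((-s * Real.log r : ℝ) : EReal) * ((|Real.log r|⁻¹ : ℝ) : EReal) := by
            rw [← EReal.coe_mul, ← h2]
        _ ≤ _ := by
            refine mul_le_mul_of_nonneg_right h1 ?_
            exact_mod_cast inv_nonneg.2 (abs_nonneg _)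
    obtain ⟨k, F, hF, hE, hk⟩ := exists_cover_of_coverNum_lt hc
    exact ⟨k, F, r, hr0, hr2, hF, hE, hk⟩
  choose k F r hr0 hr1 hF hE hk using key
  have hr : Tendsto r atTop (𝓝 0) :=
    squeeze_zero (fun n => (hr0 n).le) (fun n => (hr1 n).le) tendsto_one_div_add_atTop_nhds_zero_nat
  have hr' : Tendsto (fun n => ENNReal.ofReal (r n)) atTop (𝓝 0) := by
    simpa using ENNReal.tendsto_ofReal hr
  refine dimH_le_of_hausdorffMeasure_ne_top (ne_top_of_le_ne_top ENNReal.one_ne_top ?_)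
  refine (Measure.hausdorffMeasure_le_liminf_sum (s : ℝ) E _ hr' F
    (Eventually.of_forall hF) (Eventually.of_forall hE)).trans ?_
  refine liminf_le_of_frequently_le' (Frequently.of_forall fun n => ?_)
  calc ∑ i, Metric.ediam (F n i) ^ (s : ℝ) ≤ ∑ _i : Fin (k n), ENNReal.ofReal (r n) ^ (s : ℝ) := by
        gcongr with i
        exact hF n i
    _ = k n * ENNReal.ofReal (r n ^ (s : ℝ)) := by
        simp [ENNReal.ofReal_rpow_of_pos (hr0 n)]
    _ ≤ ENNReal.ofReal (r n ^ (-(s : ℝ))) * ENNReal.ofReal (r n ^ (s : ℝ)) := by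
        gcongr
        exact (hk n).le
    _ = 1 := by
        rw [← ENNReal.ofReal_mul (Real.rpow_nonneg (hr0 n).le _), ← Real.rpow_add (hr0 n)]
        simp

lemma dimH_le_lbdim {X : Type*} [MetricSpace X] {E : Set X} (hE : E.Nonempty) :
    (dimH E : EReal) ≤ lbdim E := by
  refine EReal.le_of_forall_lt_iff_le.1 fun z hz => ?_
  have hz0 : 0 ≤ z := by exact_mod_cast (lbdim_nonneg hE).trans hz.le
  lift z to ℝ≥0 using hz0
  exact EReal.coe_ennreal_le_coe_ennreal_iff.2 (dimH_le_of_lbdim_lt hz)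

lemma dimH_le_lpdim {X : Type*} [MetricSpace X] {E : Set X} (hE : E.Nonempty) :
    (dimH E : EReal) ≤ lpdim E := by
  refine le_iInf₂ fun G hG => ?_
  have hS : 0 ≤ ⨆ n, lbdim (G n) := by
    obtain ⟨x, hx⟩ := hE
    obtain ⟨n, hn⟩ := mem_iUnion.1 (hG hx)
    exact (lbdim_nonneg ⟨x, hn⟩).trans (le_iSup (fun n => lbdim (G n)) n)
  rw [← EReal.coe_toENNReal hS, EReal.coe_ennreal_le_coe_ennreal_iff]
  refine (dimH_mono hG).trans ?_
  rw [dimH_iUnion]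
  refine iSup_le fun n => ?_
  rcases (G n).eq_empty_or_nonempty with h | h
  · simp [h]
  · rw [← EReal.coe_ennreal_le_coe_ennreal_iff, EReal.coe_toENNReal hS]
    exact (dimH_le_lbdim h).trans (le_iSup (fun n => lbdim (G n)) n)

lemma lbdim_le_of_coverNum_le {X : Type*} [PseudoMetricSpace X] {E : Set X} {a : ℝ} {t : ℕ → ℝ}
    (ht0 : ∀ n, 0 < t n) (ht1 : ∀ n, t n < 1 / (n + 1))
    (hE : ∀ᶠ n : ℕ in atTop, coverNum (t n) E ≤ ENNReal.ofReal (t n ^ (-a - 1 / (n + 1)))) :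
    lbdim E ≤ a := by
  have ht : Tendsto t atTop (𝓝 0) :=
    squeeze_zero (fun n => (ht0 n).le) (fun n => (ht1 n).le) tendsto_one_div_add_atTop_nhds_zero_nat
  have ht' : Tendsto t atTop (𝓝[>] 0) :=
    tendsto_nhdsWithin_iff.2 ⟨ht, Eventually.of_forall ht0⟩
  refine EReal.le_of_forall_lt_iff_le.1 fun z hz => ?_
  have hz : 0 < z - a := sub_pos.2 (by exact_mod_cast hz)
  refine liminf_le_of_frequently_le' (ht'.frequently (Eventually.frequently ?_))
  filter_upwards [hE, (tendsto_one_div_add_atTop_nhds_zero_nat (𝕜 := ℝ)).eventually_lt_const hz,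
    ht.eventually_lt_const one_pos] with n hn hn2 hn3
  have hlog : Real.log (t n) < 0 := Real.log_neg (ht0 n) hn3
  have h1 := ENNReal.log_monotone hn
  rw [ENNReal.log_ofReal_of_pos (Real.rpow_pos_of_pos (ht0 n) _), Real.log_rpow (ht0 n)] at h1
  refine (mul_le_mul_of_nonneg_right h1
    (by exact_mod_cast inv_nonneg.2 (abs_nonneg _))).trans ?_
  rw [← EReal.coe_mul, EReal.coe_le_coe_iff, abs_of_neg hlog]
  have : (-a - 1 / ((n : ℝ) + 1)) * Real.log (t n) * (-Real.log (t n))⁻¹ = a + 1 / (n + 1) := by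
    have := hlog.ne
    rw [inv_neg]
    field_simp
    ring
  rw [this]
  linarith

lemma lipGauge_rpow_eq_zero {X : Type*} [PseudoMetricSpace X] {f : X → ℝ} {x : X} {t : ℕ → ℝ}
    (ht0 : ∀ n, 0 < t n) (ht1 : ∀ n, t n < 1 / (n + 1))
    (h : ∃ᶠ n : ℕ in atTop,
      Metric.ediam (f '' Metric.closedBall x (t n)) ≤ ENNReal.ofReal (t n ^ (n : ℝ))) (s : ℝ) :
    lipGauge (fun r => r ^ s) f x = 0 := by
  have ht : Tendsto t atTop (𝓝 0) :=
    squeeze_zero (fun n => (ht0 n).le) (fun n => (ht1 n).le) tendsto_one_div_add_atTop_nhds_zero_nat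
  have ht' : Tendsto t atTop (𝓝[>] 0) :=
    tendsto_nhdsWithin_iff.2 ⟨ht, Eventually.of_forall ht0⟩
  have ht2 : Tendsto (fun n => ENNReal.ofReal (t n)) atTop (𝓝 0) := by
    simpa using ENNReal.tendsto_ofReal ht
  refine le_antisymm (le_of_forall_gt fun ε hε => ?_) zero_le
  obtain ⟨ε', hε', hεε'⟩ := exists_between hε
  refine lt_of_le_of_lt (liminf_le_of_frequently_le' (ht'.frequently ?_)) hεε'
  refine (h.and_eventually ((ht2.eventually_lt_const hε').and
    (eventually_ge_atTop ⌈s + 1⌉₊))).mono ?_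
  rintro n ⟨hn, hn2, hn3⟩
  have h1 : t n < 1 := (ht1 n).trans_le
    ((div_le_one (by positivity)).2 (by linarith [n.cast_nonneg (α := ℝ)]))
  have h2 : s + 1 ≤ n := (Nat.le_ceil _).trans (by exact_mod_cast hn3)
  refine le_trans ?_ hn2.le
  refine (ENNReal.div_le_div_right hn _).trans ?_
  rw [← ENNReal.ofReal_div_of_pos (Real.rpow_pos_of_pos (ht0 n) _), ← Real.rpow_sub (ht0 n)]
  refine ENNReal.ofReal_le_ofReal ?_
  calc t n ^ ((n : ℝ) - s) ≤ t n ^ (1 : ℝ) :=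
        Real.rpow_le_rpow_of_exponent_ge (ht0 n) h1.le (by linarith)
    _ = t n := Real.rpow_one _

lemma ContinuousMap.nhds_basis_forall_dist_lt {X : Type*} [TopologicalSpace X] (g : C(X, ℝ)) :
    (𝓝 g).HasBasis (fun p : Set X × ℝ => IsCompact p.1 ∧ 0 < p.2)
      fun p => {f | ∀ x ∈ p.1, dist (g x) (f x) < p.2} :=
  nhds_basis_uniformity' Metric.uniformity_basis_dist.compactConvergenceUniformity

lemma exists_gridStair_approx {d : ℕ} {Ω : Set (EuclideanSpace ℝ (Fin d))} (c : ℝ)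
    (g : C(Ω, ℝ)) {K : Set Ω} (hK : IsCompact K) {ε : ℝ} (hε : 0 < ε) :
    ∃ (G : C(EuclideanSpace ℝ (Fin d), ℝ)) (h : ℝ), 0 < h ∧ ∀ t : ℝ, 0 < t →
      ∀ x ∈ K, dist (g x) (G (gridStair d c h t x)) < ε := by
  have := isCompact_iff_compactSpace.1 hK
  have he : IsClosedEmbedding (fun x : K => ((x : Ω) : EuclideanSpace ℝ (Fin d))) :=
    Continuous.isClosedEmbedding (by fun_prop)
      (Subtype.val_injective.comp Subtype.val_injective)
  obtain ⟨G, hG⟩ := (g.restrict K).exists_extension' he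
  have hGg : ∀ x ∈ K, G x = g x := fun x hx => congrFun hG ⟨x, hx⟩
  have hu := (hK.image continuous_subtype_val).uniformContinuousAt_of_continuousAt G
    (fun a _ => G.continuous.continuousAt) (Metric.dist_mem_uniformity hε)
  obtain ⟨δ, hδ, hu⟩ := Metric.mem_uniformity_dist.1 hu
  refine ⟨G, δ / (d + 1), by positivity, fun t ht x hx => ?_⟩
  rw [← hGg x hx]
  refine hu ?_ (mem_image_of_mem _ hx)
  refine (dist_gridStair_le ht (by positivity) _).trans_lt ?_
  rw [← mul_div_assoc, div_lt_iff₀ (by positivity)]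
  linarith

lemma eventually_const_mul_rpow_le {C ε : ℝ} (hε : 0 < ε) (a : ℝ) :
    ∀ᶠ t : ℝ in 𝓝[>] 0, C * t ^ (-a) ≤ t ^ (-a - ε) := by
  have h : Tendsto (fun t : ℝ => C * t ^ ε) (𝓝[>] 0) (𝓝 0) := by
    have h1 : Tendsto (fun t : ℝ => t ^ ε) (𝓝 0) (𝓝 0) := by
      simpa [Real.zero_rpow hε.ne'] using (Real.continuous_rpow_const hε.le).tendsto 0
    simpa using (h1.mono_left nhdsWithin_le_nhds).const_mul C
  filter_upwards [h.eventually_le_const one_pos, self_mem_nhdsWithin] with t ht ht0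
  have ht0 : 0 < t := ht0
  calc C * t ^ (-a) = C * t ^ ε * t ^ (-a - ε) := by
        rw [mul_assoc, ← Real.rpow_add ht0]
        ring_nf
    _ ≤ 1 * t ^ (-a - ε) := by gcongr
    _ = _ := one_mul _

lemma eventually_residual_exists_slab {d : ℕ} (hd : 0 < d)
    {Ω : Set (EuclideanSpace ℝ (Fin d))} (c : ℝ) (n : ℕ) {K L : Set Ω}
    (hK : IsCompact K) (hL : IsCompact L) (hKL : K ⊆ interior L) :
    ∀ᶠ f : C(Ω, ℝ) in residual C(Ω, ℝ),
      ∃ t : ℝ, 0 < t ∧ t < 1 / (n + 1) ∧ ∃ S : Set (EuclideanSpace ℝ (Fin d)), IsClosed S ∧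
        (∀ x : EuclideanSpace ℝ (Fin d), (∃ i, x i = c) → x ∈ S) ∧
        coverNum t (S ∩ Metric.closedBall 0 n) ≤
          ENNReal.ofReal (t ^ (-((d - 1 : ℕ) : ℝ) - 1 / (n + 1))) ∧
        ∀ x ∈ K, (x : EuclideanSpace ℝ (Fin d)) ∉ S →
          Metric.ediam (f '' Metric.closedBall x t) ≤ ENNReal.ofReal (t ^ (n : ℝ)) := by
  refine mem_of_superset (residual_of_dense_open isOpen_interior fun g => ?_) interior_subset
  rw [mem_closure_iff_nhds_basis (ContinuousMap.nhds_basis_forall_dist_lt g)]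
  rintro ⟨K', ε⟩ ⟨hK', hε⟩
  obtain ⟨G, h, hh, hG⟩ := exists_gridStair_approx c g hK' hε
  obtain ⟨δ, hδ, hδL⟩ := hK.exists_cthickening_subset_open isOpen_interior hKL
  obtain ⟨C, hC⟩ := exists_coverNum_gridSlab_le hd c hh (n.cast_nonneg (α := ℝ))
  have hn : (0 : ℝ) < 1 / (n + 1) := by positivity
  have hsmall : ∀ᶠ t : ℝ in 𝓝[>] (0 : ℝ), t ∈ Ioo (0 : ℝ) (min (min 1 h) (min δ (1 / (n + 1)))) :=
    Ioo_mem_nhdsGT (by positivity)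
  obtain ⟨t, hCt, ht0, ht⟩ :=
    ((eventually_const_mul_rpow_le (C := C) hn ((d - 1 : ℕ) : ℝ)).and hsmall).exists
  obtain ⟨⟨ht1, hth⟩, htδ, htn⟩ := by simpa only [lt_min_iff] using ht
  let g' : C(Ω, ℝ) := ⟨fun x => G (gridStair d c h t x),
    G.continuous.comp ((continuous_gridStair ht0 hth.le).comp continuous_subtype_val)⟩
  refine ⟨g', mem_interior_iff_mem_nhds.2 ?_, hG t ht0⟩
  refine (ContinuousMap.nhds_basis_forall_dist_lt g').mem_of_superset
    (i := (L, t ^ (n : ℝ) / 2)) ⟨hL, by positivity⟩ fun f hf => ?_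
  refine ⟨t, ht0, htn, gridSlab d c h t, isClosed_gridSlab d c h t,
    fun x ⟨i, hi⟩ => mem_gridSlab_of_eq hh ht0 hi,
    (hC t ht0 ht1).trans (ENNReal.ofReal_le_ofReal hCt), fun x hx hxS => ?_⟩
  have hval : ∀ y ∈ Metric.closedBall x t, dist (g' x) (f y) < t ^ (n : ℝ) / 2 := by
    intro y hy
    have hyL : y ∈ L := interior_subset (hδL (Metric.closedBall_subset_cthickening hx δ
      (Metric.closedBall_subset_closedBall htδ.le hy)))
    have e : g' y = g' x := congrArg G (gridStair_eq_of_notMem ht0 hh hxS hy)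
    rw [← e]
    exact hf y hyL
  refine Metric.ediam_le ?_
  rintro _ ⟨y, hy, rfl⟩ _ ⟨z, hz, rfl⟩
  rw [edist_dist]
  refine ENNReal.ofReal_le_ofReal ?_
  linarith [dist_triangle_left (f y) (f z) (g' x), hval y hy, hval z hz]

lemma eventually_residual_exists_Fsigma {d : ℕ} (hd : 0 < d)
    {Ω : Set (EuclideanSpace ℝ (Fin d))} [LocallyCompactSpace Ω] (c : ℝ) :
    ∀ᶠ f : C(Ω, ℝ) in residual C(Ω, ℝ),
      ∃ F : Set (EuclideanSpace ℝ (Fin d)), F ⊆ Ω ∧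
        (∃ C : ℕ → Set (EuclideanSpace ℝ (Fin d)),
          (∀ n, IsClosed (C n)) ∧ F = Ω ∩ ⋃ n, C n) ∧
        (∀ x (hx : x ∈ Ω), x ∉ F →
          ∀ s : ℝ, 0 < s → lipGauge (fun r => r ^ s) (⇑f) ⟨x, hx⟩ = 0) ∧
        lpdim F ≤ ((d - 1 : ℕ) : EReal) ∧ ∀ x ∈ Ω, (∃ i, x i = c) → x ∈ F := by
  let K : CompactExhaustion Ω := default
  have hall := eventually_countable_forall.2 fun n : ℕ => eventually_residual_exists_slab hd c n
    (K.isCompact n) (K.isCompact (n + 1)) (K.subset_interior_succ n)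
  filter_upwards [hall] with f hf
  choose t ht0 ht1 S hS hSc hcov hdiam using hf
  let C : ℕ → Set (EuclideanSpace ℝ (Fin d)) := fun m => ⋂ n ≥ m, S n
  refine ⟨Ω ∩ ⋃ m, C m, inter_subset_left,
    ⟨C, fun m => isClosed_biInter fun n _ => hS n, rfl⟩, fun x hx hxF s _ => ?_, ?_,
    fun x hx hxc => ⟨hx, mem_iUnion.2 ⟨0, mem_iInter₂.2 fun n _ => hSc n x hxc⟩⟩⟩
  · refine lipGauge_rpow_eq_zero ht0 ht1 (frequently_atTop.2 fun N => ?_) s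
    obtain ⟨j, hj⟩ := K.exists_mem ⟨x, hx⟩
    have hxC : x ∉ C (max N j) := fun h => hxF ⟨hx, mem_iUnion.2 ⟨_, h⟩⟩
    simp only [C, mem_iInter, not_forall] at hxC
    obtain ⟨n, hn, hxS⟩ := hxC
    exact ⟨n, (le_max_left _ _).trans hn,
      hdiam n _ (K.subset ((le_max_right _ _).trans hn) hj) hxS⟩
  · refine iInf₂_le_of_le (fun m => C m ∩ Metric.closedBall 0 m) ?_ (iSup_le fun m => ?_)
    · rintro x ⟨-, hx⟩
      obtain ⟨m, hm⟩ := mem_iUnion.1 hx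
      obtain ⟨k, hk⟩ := exists_nat_ge ‖x‖
      refine mem_iUnion.2 ⟨max m k, mem_iInter₂.2 fun n hn =>
        mem_iInter₂.1 hm n ((le_max_left _ _).trans hn), mem_closedBall_zero_iff.2 ?_⟩
      exact hk.trans (by exact_mod_cast le_max_right m k)
    · refine (lbdim_le_of_coverNum_le (a := ((d - 1 : ℕ) : ℝ)) ht0 ht1 ?_).trans_eq (by simp)
      filter_upwards [eventually_ge_atTop m] with n hn
      refine (coverNum_mono ?_).trans (hcov n)
      exact inter_subset_inter (biInter_subset_of_mem hn)
        (Metric.closedBall_subset_closedBall (by exact_mod_cast hn))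

lemma le_dimH_of_forall_eq_mem {m : ℕ} {Ω F : Set (EuclideanSpace ℝ (Fin (m + 1)))}
    {p : EuclideanSpace ℝ (Fin (m + 1))} (hp : p ∈ interior Ω)
    (hF : ∀ x ∈ Ω, x 0 = p 0 → x ∈ F) : (m : ℝ≥0∞) ≤ dimH F := by
  let e : EuclideanSpace ℝ (Fin m) → EuclideanSpace ℝ (Fin (m + 1)) := fun y =>
    WithLp.toLp 2 (Fin.cons (p 0) y)
  have he : Isometry e := Isometry.of_dist_eq fun x y => by
    simp [e, EuclideanSpace.dist_eq, Fin.sum_univ_succ]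
  have hpe : e (WithLp.toLp 2 fun i => p i.succ) = p := by
    ext i
    refine Fin.cases ?_ (fun j => ?_) i <;> simp [e]
  have hsub : e '' (e ⁻¹' Ω) ⊆ F := by
    rintro _ ⟨y, hy, rfl⟩
    exact hF _ hy (by simp [e])
  have hnhds : e ⁻¹' Ω ∈ 𝓝 (WithLp.toLp 2 fun i : Fin m => p i.succ) := by
    refine he.continuous.continuousAt.preimage_mem_nhds ?_
    rw [hpe]
    exact mem_interior_iff_mem_nhds.1 hp
  calc (m : ℝ≥0∞) = dimH (e ⁻¹' Ω) := by rw [Real.dimH_of_mem_nhds hnhds]; simp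
    _ = dimH (e '' (e ⁻¹' Ω)) := (he.dimH_image _).symm
    _ ≤ dimH F := dimH_mono hsub

theorem stmt4
    (d : ℕ) (hd : 0 < d) (Ω : Set (EuclideanSpace ℝ (Fin d)))
    (hΩ : LocallyCompactSpace Ω) :
    (∀ᶠ f : C(↥Ω, ℝ) in residual C(↥Ω, ℝ),
      ∃ F : Set (EuclideanSpace ℝ (Fin d)), F ⊆ Ω ∧
        (∃ C : ℕ → Set (EuclideanSpace ℝ (Fin d)),
          (∀ n, IsClosed (C n)) ∧ F = Ω ∩ ⋃ n, C n) ∧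
        (∀ x (hx : x ∈ Ω), x ∉ F →
          ∀ s : ℝ, 0 < s → lipGauge (fun r => r ^ s) (⇑f) ⟨x, hx⟩ = 0) ∧
        lpdim F ≤ ((d - 1 : ℕ) : EReal)) ∧
    ((interior Ω).Nonempty →
      ∀ᶠ f : C(↥Ω, ℝ) in residual C(↥Ω, ℝ),
        ∃ F : Set (EuclideanSpace ℝ (Fin d)), F ⊆ Ω ∧
          (∃ C : ℕ → Set (EuclideanSpace ℝ (Fin d)),
            (∀ n, IsClosed (C n)) ∧ F = Ω ∩ ⋃ n, C n) ∧
          (∀ x (hx : x ∈ Ω), x ∉ F →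
            ∀ s : ℝ, 0 < s → lipGauge (fun r => r ^ s) (⇑f) ⟨x, hx⟩ = 0) ∧
          lpdim F = ((d - 1 : ℕ) : EReal) ∧ dimH F = ((d - 1 : ℕ) : ℝ≥0∞)) := by
  refine ⟨?_, fun ⟨p, hp⟩ => ?_⟩
  · filter_upwards [eventually_residual_exists_Fsigma hd (Ω := Ω) 0] with f hf
    obtain ⟨F, h1, h2, h3, h4, -⟩ := hf
    exact ⟨F, h1, h2, h3, h4⟩
  · obtain ⟨m, rfl⟩ := Nat.exists_eq_succ_of_ne_zero hd.ne'
    filter_upwards [eventually_residual_exists_Fsigma hd (Ω := Ω) (p 0)] with f hf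
    obtain ⟨F, h1, h2, h3, h4, h5⟩ := hf
    have hdim : (m : ℝ≥0∞) ≤ dimH F :=
      le_dimH_of_forall_eq_mem hp fun x hx hx0 => h5 x hx ⟨0, hx0⟩
    have hle := dimH_le_lpdim ⟨p, h5 p (interior_subset hp) ⟨0, rfl⟩⟩
    have hm : (((m : ℝ≥0∞)) : EReal) = (m : EReal) := rfl
    have hdim' : (m : EReal) ≤ dimH F := hm ▸ EReal.coe_ennreal_le_coe_ennreal_iff.2 hdim
    refine ⟨F, h1, h2, h3, le_antisymm h4 (hdim'.trans hle), le_antisymm ?_ hdim⟩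
    exact EReal.coe_ennreal_le_coe_ennreal_iff.1 ((hle.trans h4).trans_eq hm.symm)
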